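/- arXiv:2102.13317 — 4 statements merged into one kernel-verified Lean document; each statement's English description precedes it below -/
import Mathlib

section
/- Let φ : A → B(H) and ψ : B → B(K) be completely positive linear maps with minimal Stinespring representations (π_φ, V_φ, H_φ) and (π_ψ, V_ψ, H_ψ), let X be an A–B-equivalence bimodule and π_X : X → B(H_ψ, H_φ) a linear map such that (π_φ, π_X, π_ψ) is a representation of X on (H_φ, H_ψ), let ρ be the induced representation of the linking C*-algebra L_X on H_φ⊕H_ψ, ρ([[a,x],[ỹ,b]]) = [[π_φ(a), π_X(x)],[π_X(y)*, π_ψ(b)]], and define τ : L_X → B(H⊕K) by τ(l) = (V_φ⊕V_ψ)* ρ(l) (V_φ⊕V_ψ). Then (ρ, V_φ⊕V_ψ, H_φ⊕H_ψ) is a minimal Stinespring representation for τ. -/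
open Filter Matrix
open scoped InnerProductSpace ComplexOrder

noncomputable section

universe u v w

/-- A bundled complex Hilbert space. -/
structure HilbertSpaceCat where
  carrier : Type*
  [nacg : NormedAddCommGroup carrier]
  [ips : InnerProductSpace ℂ carrier]
  [cs : CompleteSpace carrier]

attribute [instance] HilbertSpaceCat.nacg HilbertSpaceCat.ips HilbertSpaceCat.cs

/-- An `A–B`-equivalence bimodule between C*-algebras `A` and `B`: a complex Banach space with
commuting left `A`- and right `B`-actions, a full `A`-valued inner product (linear in the first
variable) and a full `B`-valued inner product (linear in the second variable), satisfying the
usual compatibility axioms, complete in the norm `‖x‖ = ‖⟨x,x⟩_B‖^{1/2}`. -/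
structure CstarEquivBimodule (A B : Type*)
    [NonUnitalCStarAlgebra A] [PartialOrder A] [StarOrderedRing A]
    [NonUnitalCStarAlgebra B] [PartialOrder B] [StarOrderedRing B] where
  carrier : Type*
  [nacg : NormedAddCommGroup carrier]
  [nsp : NormedSpace ℂ carrier]
  [cs : CompleteSpace carrier]
  /-- the left action of `A`: `lsmul a x = a · x` -/
  lsmul : A →ₗ[ℂ] carrier →ₗ[ℂ] carrier
  /-- the right action of `B`: `rsmul b x = x · b` -/
  rsmul : B →ₗ[ℂ] carrier →ₗ[ℂ] carrier
  /-- the `A`-valued inner product `⟨x,y⟩_A`, linear in `x`, conjugate-linear in `y` -/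
  innerA : carrier →ₗ[ℂ] carrier →ₗ⋆[ℂ] A
  /-- the `B`-valued inner product `⟨x,y⟩_B`, conjugate-linear in `x`, linear in `y` -/
  innerB : carrier →ₗ⋆[ℂ] carrier →ₗ[ℂ] B
  lsmul_mul : ∀ (a a' : A) x, lsmul (a * a') x = lsmul a (lsmul a' x)
  rsmul_mul : ∀ (b b' : B) x, rsmul (b * b') x = rsmul b' (rsmul b x)
  lsmul_rsmul_comm : ∀ (a : A) (b : B) x, rsmul b (lsmul a x) = lsmul a (rsmul b x)
  innerA_star : ∀ x y, star (innerA x y) = innerA y x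
  innerB_star : ∀ x y, star (innerB x y) = innerB y x
  innerA_lsmul : ∀ (a : A) x y, innerA (lsmul a x) y = a * innerA x y
  innerB_rsmul : ∀ (b : B) x y, innerB x (rsmul b y) = innerB x y * b
  /-- the imprimitivity condition `⟨x,y⟩_A · z = x · ⟨y,z⟩_B` -/
  imprimitivity : ∀ x y z, lsmul (innerA x y) z = rsmul (innerB y z) x
  innerA_nonneg : ∀ x, 0 ≤ innerA x x
  innerB_nonneg : ∀ x, 0 ≤ innerB x x
  /-- the norm on the bimodule is `‖x‖ = ‖⟨x,x⟩_B‖^{1/2}` -/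
  norm_sq_eq : ∀ x, ‖x‖ ^ 2 = ‖innerB x x‖
  /-- fullness of the `A`-valued inner product -/
  fullA : (Submodule.span ℂ {a : A | ∃ x y, a = innerA x y}).topologicalClosure = ⊤
  /-- fullness of the `B`-valued inner product -/
  fullB : (Submodule.span ℂ {b : B | ∃ x y, b = innerB x y}).topologicalClosure = ⊤

attribute [instance] CstarEquivBimodule.nacg CstarEquivBimodule.nsp CstarEquivBimodule.cs

variable {A B : Type*}
  [NonUnitalCStarAlgebra A] [PartialOrder A] [StarOrderedRing A]
  [NonUnitalCStarAlgebra B] [PartialOrder B] [StarOrderedRing B]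

/-- A representation `π` of a C*-algebra on a Hilbert space `H` is non-degenerate if the closed
linear span of `π(A)H` is all of `H`. -/
def NondegenerateRep {H : Type*} [NormedAddCommGroup H] [InnerProductSpace ℂ H] [CompleteSpace H]
    (π : A →⋆ₙₐ[ℂ] (H →L[ℂ] H)) : Prop :=
  (Submodule.span ℂ {ξ : H | ∃ (a : A) (v : H), ξ = π a v}).topologicalClosure = ⊤

/-- `(π_A, π_X, π_B)` is a representation of the `A–B`-equivalence bimodule `X` on the pair of
Hilbert spaces `(H, K)`. -/
structure IsBimoduleRepn (E : CstarEquivBimodule A B)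
    {H K : Type*} [NormedAddCommGroup H] [InnerProductSpace ℂ H] [CompleteSpace H]
    [NormedAddCommGroup K] [InnerProductSpace ℂ K] [CompleteSpace K]
    (πA : A →⋆ₙₐ[ℂ] (H →L[ℂ] H)) (πX : E.carrier →ₗ[ℂ] (K →L[ℂ] H))
    (πB : B →⋆ₙₐ[ℂ] (K →L[ℂ] K)) : Prop where
  nondegA : NondegenerateRep πA
  nondegB : NondegenerateRep πB
  /-- `π_X(x) π_X(y)* = π_A(⟨x,y⟩_A)` -/
  map_innerA : ∀ x y, (πX x) ∘L (ContinuousLinearMap.adjoint (πX y)) = πA (E.innerA x y)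
  /-- `π_X(x)* π_X(y) = π_B(⟨x,y⟩_B)` -/
  map_innerB : ∀ x y, (ContinuousLinearMap.adjoint (πX x)) ∘L (πX y) = πB (E.innerB x y)
  /-- `π_X(a·x·b) = π_A(a) π_X(x) π_B(b)` -/
  map_smul' : ∀ (a : A) (b : B) x,
    πX (E.rsmul b (E.lsmul a x)) = (πA a) ∘L ((πX x) ∘L (πB b))

/-- Strong Morita equivalence of (non-degenerate) representations of C*-algebras. -/
def RepnSME.{w'} {H K : Type*} [NormedAddCommGroup H] [InnerProductSpace ℂ H] [CompleteSpace H]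
    [NormedAddCommGroup K] [InnerProductSpace ℂ K] [CompleteSpace K]
    (πA : A →⋆ₙₐ[ℂ] (H →L[ℂ] H)) (πB : B →⋆ₙₐ[ℂ] (K →L[ℂ] K)) : Prop :=
  ∃ (E : CstarEquivBimodule.{_, _, w'} A B) (πX : E.carrier →ₗ[ℂ] (K →L[ℂ] H)),
    IsBimoduleRepn E πA πX πB

/-- `(π, V, Hφ)` is a minimal Stinespring representation of `φ : A → B(H)`. -/
structure IsMinimalStinespring {H Hφ : Type*}
    [NormedAddCommGroup H] [InnerProductSpace ℂ H] [CompleteSpace H]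
    [NormedAddCommGroup Hφ] [InnerProductSpace ℂ Hφ] [CompleteSpace Hφ]
    (φ : A →ₗ[ℂ] (H →L[ℂ] H)) (π : A →⋆ₙₐ[ℂ] (Hφ →L[ℂ] Hφ)) (V : H →L[ℂ] Hφ) : Prop where
  dilation : ∀ a : A, φ a = (ContinuousLinearMap.adjoint V) ∘L ((π a) ∘L V)
  minimal :
    (Submodule.span ℂ {ξ : Hφ | ∃ (a : A) (v : H), ξ = π a (V v)}).topologicalClosure = ⊤

/-- A linear map between C*-algebras is completely positive if every matrix amplification maps
positive elements to positive elements (positivity being expressed by the C*-characterization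
`M ≥ 0 ↔ M = P* P`). -/
def IsCompletelyPositive {A' N : Type*}
    [NonUnitalRing A'] [StarRing A'] [Module ℂ A']
    [NonUnitalRing N] [StarRing N] [Module ℂ N] (φ : A' →ₗ[ℂ] N) : Prop :=
  ∀ (m : ℕ) (M : Matrix (Fin m) (Fin m) A'),
    (∃ P : Matrix (Fin m) (Fin m) A', M = Pᴴ * P) →
    ∃ Q : Matrix (Fin m) (Fin m) N, M.map φ = Qᴴ * Q

/-- Strong Morita equivalence of completely positive maps: some minimal Stinespring
representation of `φ` is strongly Morita equivalent to some minimal Stinespring representation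
of `ψ`. -/
def CPStronglyMoritaEquiv {H K : Type*}
    [NormedAddCommGroup H] [InnerProductSpace ℂ H] [CompleteSpace H]
    [NormedAddCommGroup K] [InnerProductSpace ℂ K] [CompleteSpace K]
    (φ : A →ₗ[ℂ] (H →L[ℂ] H)) (ψ : B →ₗ[ℂ] (K →L[ℂ] K)) : Prop :=
  ∃ (Hφ Hψ : HilbertSpaceCat.{v})
    (πφ : A →⋆ₙₐ[ℂ] (Hφ.carrier →L[ℂ] Hφ.carrier)) (Vφ : H →L[ℂ] Hφ.carrier)
    (πψ : B →⋆ₙₐ[ℂ] (Hψ.carrier →L[ℂ] Hψ.carrier)) (Vψ : K →L[ℂ] Hψ.carrier),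
    IsMinimalStinespring φ πφ Vφ ∧ IsMinimalStinespring ψ πψ Vψ ∧ RepnSME.{_, _, w} (H := Hφ.carrier) (K := Hψ.carrier) πφ πψ

end

section Linking

variable {A B : Type*}
  [NonUnitalCStarAlgebra A] [PartialOrder A] [StarOrderedRing A]
  [NonUnitalCStarAlgebra B] [PartialOrder B] [StarOrderedRing B]

/-- `L`, together with embeddings `ιA`, `ιB` of the algebras and `ιX` of the bimodule,
is a linking C*-algebra for the `A–B`-equivalence bimodule `E`; the corner `ιX x * star (ιX y)`
realizes the `A`-valued inner product, `star (ιX x) * ιX y` the `B`-valued inner product, and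
`L` is generated by the four corners (`star ∘ ιX` plays the role of the dual module `X̃`). -/
structure IsLinkingAlgebra (E : CstarEquivBimodule A B)
    (L : Type*) [NonUnitalCStarAlgebra L]
    (ιA : A →⋆ₙₐ[ℂ] L) (ιB : B →⋆ₙₐ[ℂ] L) (ιX : E.carrier →ₗ[ℂ] L) : Prop where
  injA : Function.Injective ιA
  injB : Function.Injective ιB
  injX : Function.Injective ιX
  mul_star_eq : ∀ x y, ιX x * star (ιX y) = ιA (E.innerA x y)
  star_mul_eq : ∀ x y, star (ιX x) * ιX y = ιB (E.innerB x y)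
  algA_mul : ∀ (a : A) x, ιA a * ιX x = ιX (E.lsmul a x)
  mul_algB : ∀ (b : B) x, ιX x * ιB b = ιX (E.rsmul b x)
  corner_zero : ∀ (a : A) (b : B), ιA a * ιB b = 0
  generates : (Submodule.span ℂ
      (Set.range ⇑ιA ∪ Set.range ⇑ιB ∪ Set.range ⇑ιX ∪
        star '' Set.range ⇑ιX)).topologicalClosure = ⊤

end Linking

/-- The canonical isometric inclusion of `H` into the Hilbert space direct sum `H ⊕ K`. -/
noncomputable def hilbertInl (H K : Type*)
    [NormedAddCommGroup H] [InnerProductSpace ℂ H] [CompleteSpace H]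
    [NormedAddCommGroup K] [InnerProductSpace ℂ K] [CompleteSpace K] :
    H →L[ℂ] WithLp 2 (H × K) :=
  ((WithLp.prodContinuousLinearEquiv 2 ℂ H K).symm :
      (H × K) →L[ℂ] WithLp 2 (H × K)).comp (ContinuousLinearMap.inl ℂ H K)

/-- The canonical isometric inclusion of `K` into the Hilbert space direct sum `H ⊕ K`. -/
noncomputable def hilbertInr (H K : Type*)
    [NormedAddCommGroup H] [InnerProductSpace ℂ H] [CompleteSpace H]
    [NormedAddCommGroup K] [InnerProductSpace ℂ K] [CompleteSpace K] :
    K →L[ℂ] WithLp 2 (H × K) :=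
  ((WithLp.prodContinuousLinearEquiv 2 ℂ H K).symm :
      (H × K) →L[ℂ] WithLp 2 (H × K)).comp (ContinuousLinearMap.inr ℂ H K)

/-- The direct sum `S ⊕ T` of two operators, as an operator between Hilbert space direct sums. -/
noncomputable def hilbertProdMap {H K H' K' : Type*}
    [NormedAddCommGroup H] [InnerProductSpace ℂ H] [CompleteSpace H]
    [NormedAddCommGroup K] [InnerProductSpace ℂ K] [CompleteSpace K]
    [NormedAddCommGroup H'] [InnerProductSpace ℂ H'] [CompleteSpace H']
    [NormedAddCommGroup K'] [InnerProductSpace ℂ K'] [CompleteSpace K']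
    (S : H →L[ℂ] H') (T : K →L[ℂ] K') :
    WithLp 2 (H × K) →L[ℂ] WithLp 2 (H' × K') :=
  ((WithLp.prodContinuousLinearEquiv 2 ℂ H' K').symm :
      (H' × K') →L[ℂ] WithLp 2 (H' × K')) ∘L
    ((S.prodMap T) ∘L
      ((WithLp.prodContinuousLinearEquiv 2 ℂ H K) :
        WithLp 2 (H × K) →L[ℂ] (H × K)))

section DirectSum

open ContinuousLinearMap

variable {H K H' K' : Type*}
  [NormedAddCommGroup H] [InnerProductSpace ℂ H] [CompleteSpace H]
  [NormedAddCommGroup K] [InnerProductSpace ℂ K] [CompleteSpace K]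
  [NormedAddCommGroup H'] [InnerProductSpace ℂ H'] [CompleteSpace H']
  [NormedAddCommGroup K'] [InnerProductSpace ℂ K'] [CompleteSpace K']

theorem adjoint_hilbertInl_hilbertInl (v : H) :
    adjoint (hilbertInl H K) (hilbertInl H K v) = v := by
  refine ext_inner_right ℂ fun w => ?_
  rw [adjoint_inner_left]
  simp [hilbertInl]

theorem adjoint_hilbertInr_hilbertInr (v : K) :
    adjoint (hilbertInr H K) (hilbertInr H K v) = v := by
  refine ext_inner_right ℂ fun w => ?_
  rw [adjoint_inner_left]
  simp [hilbertInr]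

theorem hilbertProdMap_hilbertInl (S : H →L[ℂ] H') (T : K →L[ℂ] K') (v : H) :
    hilbertProdMap S T (hilbertInl H K v) = hilbertInl H' K' (S v) := by
  simp [hilbertProdMap, hilbertInl]

theorem hilbertProdMap_hilbertInr (S : H →L[ℂ] H') (T : K →L[ℂ] K') (v : K) :
    hilbertProdMap S T (hilbertInr H K v) = hilbertInr H' K' (T v) := by
  simp [hilbertProdMap, hilbertInr]

theorem hilbertInl_add_hilbertInr (z : WithLp 2 (H × K)) :
    hilbertInl H K z.fst + hilbertInr H K z.snd = z := by
  simp [hilbertInl, hilbertInr, ← WithLp.toLp_add]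
  rfl

end DirectSum

/-- A closed subspace containing the image under a continuous linear map of a set with dense span
contains the whole range. -/
theorem ContinuousLinearMap.apply_mem_of_span_dense {V W : Type*}
    [NormedAddCommGroup V] [NormedSpace ℂ V] [NormedAddCommGroup W] [NormedSpace ℂ W]
    {s : Set V} (hs : (Submodule.span ℂ s).topologicalClosure = ⊤) (f : V →L[ℂ] W)
    {M : Submodule ℂ W} (hM : IsClosed (M : Set W)) (hf : ∀ x ∈ s, f x ∈ M) (v : V) :
    f v ∈ M := by
  have hle : (Submodule.span ℂ s).topologicalClosure ≤ M.comap (f : V →ₗ[ℂ] W) :=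
    Submodule.topologicalClosure_minimal _ (Submodule.span_le.2 hf) (hM.preimage f.continuous)
  rw [hs] at hle
  exact hle Submodule.mem_top

/-- Given completely positive maps `φ : A → B(H)`, `ψ : B → B(K)` with minimal
Stinespring representations `(π_φ, V_φ, H_φ)`, `(π_ψ, V_ψ, H_ψ)`, a representation
`(π_φ, π_X, π_ψ)` of an `A–B`-equivalence bimodule `X` on `(H_φ, H_ψ)`, the induced
representation `ρ` of the linking algebra `L_X` on `H_φ ⊕ H_ψ`, and
`τ(l) = (V_φ ⊕ V_ψ)* ρ(l) (V_φ ⊕ V_ψ)`, the triple `(ρ, V_φ ⊕ V_ψ, H_φ ⊕ H_ψ)` is a minimal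
Stinespring representation for `τ`. -/
theorem linking_stinespring_minimal
    {A B : Type*}
    [NonUnitalCStarAlgebra A] [PartialOrder A] [StarOrderedRing A]
    [NonUnitalCStarAlgebra B] [PartialOrder B] [StarOrderedRing B]
    {H K Hφ Hψ : Type*}
    [NormedAddCommGroup H] [InnerProductSpace ℂ H] [CompleteSpace H]
    [NormedAddCommGroup K] [InnerProductSpace ℂ K] [CompleteSpace K]
    [NormedAddCommGroup Hφ] [InnerProductSpace ℂ Hφ] [CompleteSpace Hφ]
    [NormedAddCommGroup Hψ] [InnerProductSpace ℂ Hψ] [CompleteSpace Hψ]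
    (φ : A →ₗ[ℂ] (H →L[ℂ] H)) (ψ : B →ₗ[ℂ] (K →L[ℂ] K))
    (hφcp : IsCompletelyPositive φ) (hψcp : IsCompletelyPositive ψ)
    (πφ : A →⋆ₙₐ[ℂ] (Hφ →L[ℂ] Hφ)) (Vφ : H →L[ℂ] Hφ)
    (πψ : B →⋆ₙₐ[ℂ] (Hψ →L[ℂ] Hψ)) (Vψ : K →L[ℂ] Hψ)
    (hφ : IsMinimalStinespring φ πφ Vφ) (hψ : IsMinimalStinespring ψ πψ Vψ)
    (E : CstarEquivBimodule A B) (πX : E.carrier →ₗ[ℂ] (Hψ →L[ℂ] Hφ))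
    (hrep : IsBimoduleRepn E πφ πX πψ)
    (L : Type*) [NonUnitalCStarAlgebra L] [PartialOrder L] [StarOrderedRing L]
    (ιA : A →⋆ₙₐ[ℂ] L) (ιB : B →⋆ₙₐ[ℂ] L) (ιX : E.carrier →ₗ[ℂ] L)
    (hL : IsLinkingAlgebra E L ιA ιB ιX)
    (ρ : L →⋆ₙₐ[ℂ] (WithLp 2 (Hφ × Hψ) →L[ℂ] WithLp 2 (Hφ × Hψ)))
    (hρA : ∀ a : A, ρ (ιA a) =
      hilbertInl Hφ Hψ ∘L ((πφ a) ∘L ContinuousLinearMap.adjoint (hilbertInl Hφ Hψ)))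
    (hρX : ∀ x : E.carrier, ρ (ιX x) =
      hilbertInl Hφ Hψ ∘L ((πX x) ∘L ContinuousLinearMap.adjoint (hilbertInr Hφ Hψ)))
    (hρB : ∀ b : B, ρ (ιB b) =
      hilbertInr Hφ Hψ ∘L ((πψ b) ∘L ContinuousLinearMap.adjoint (hilbertInr Hφ Hψ)))
    (τ : L →ₗ[ℂ] (WithLp 2 (H × K) →L[ℂ] WithLp 2 (H × K)))
    (hτ : ∀ l : L, τ l =
      ContinuousLinearMap.adjoint (hilbertProdMap Vφ Vψ) ∘L ((ρ l) ∘L hilbertProdMap Vφ Vψ)) :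
    IsMinimalStinespring τ ρ (hilbertProdMap Vφ Vψ) := by
  refine ⟨hτ, eq_top_iff.2 fun z _ => ?_⟩
  rw [← hilbertInl_add_hilbertInr z]
  refine Submodule.add_mem _ ?_ ?_
  · refine ContinuousLinearMap.apply_mem_of_span_dense hφ.minimal (hilbertInl Hφ Hψ)
      (Submodule.isClosed_topologicalClosure _) ?_ z.fst
    rintro _ ⟨a, v, rfl⟩
    refine Submodule.le_topologicalClosure _
      (Submodule.subset_span ⟨ιA a, hilbertInl H K v, ?_⟩)
    rw [hilbertProdMap_hilbertInl, hρA, ContinuousLinearMap.comp_apply,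
      ContinuousLinearMap.comp_apply, adjoint_hilbertInl_hilbertInl]
  · refine ContinuousLinearMap.apply_mem_of_span_dense hψ.minimal (hilbertInr Hφ Hψ)
      (Submodule.isClosed_topologicalClosure _) ?_ z.snd
    rintro _ ⟨b, v, rfl⟩
    refine Submodule.le_topologicalClosure _
      (Submodule.subset_span ⟨ιB b, hilbertInr H K v, ?_⟩)
    rw [hilbertProdMap_hilbertInr, hρB, ContinuousLinearMap.comp_apply,
      ContinuousLinearMap.comp_apply, adjoint_hilbertInr_hilbertInr]
end

section
/- Let A and B be C*-algebras, X an A–B-equivalence bimodule, u₁, …, u_n elements of X, K a Hilbert space, and ψ : B → B(K) a completely positive linear map. Then the linear map φ : A → B(K) ⊗ M_n(ℂ) ≅ M_n(B(K)) defined entrywise by φ(a)_{ij} = ψ(⟨u_i, a·u_j⟩_B) for 1 ≤ i, j ≤ n is completely positive. -/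
open Filter Matrix
open scoped InnerProductSpace ComplexOrder

/-- Compressing a self-adjoint element `T` of a C*-algebra by its negative part `D` produces a
nonpositive element, which vanishes only if `T` is positive. -/
theorem IsSelfAdjoint.exists_compression_eq_neg_star_mul_self {E : Type*}
    [NonUnitalCStarAlgebra E] {T : E} (hT : IsSelfAdjoint T) :
    ∃ D R : E, IsSelfAdjoint D ∧ D * T * D = -(star R * R) ∧
      (R = 0 → ∃ S : E, T = star S * S) := by
  let _ := CStarAlgebra.spectralOrder E
  have _ := CStarAlgebra.spectralOrderedRing E
  have hD : IsSelfAdjoint T⁻ := .of_nonneg (CFC.negPart_nonneg T)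
  have hcube : 0 ≤ T⁻ * T⁻ * T⁻ := by
    simpa [hD.star_eq] using star_left_conjugate_nonneg (CFC.negPart_nonneg T) T⁻
  obtain ⟨R, hR⟩ := CStarAlgebra.nonneg_iff_eq_star_mul_self.mp hcube
  refine ⟨T⁻, R, hD, ?_, fun hR0 => ?_⟩
  · have hDT : T⁻ * T = -(T⁻ * T⁻) := by
      simpa [mul_sub, CFC.negPart_mul_posPart] using
        congrArg (T⁻ * ·) (CFC.posPart_sub_negPart T hT).symm
    rw [hDT, neg_mul, hR]
  · have h3 : T⁻ * T⁻ * T⁻ = 0 := by rw [hR, hR0, mul_zero]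
    have h2 : T⁻ * T⁻ = 0 := by
      rw [← CStarRing.star_mul_self_eq_zero_iff, star_mul, hD.star_eq, ← mul_assoc, h3, zero_mul]
    have h1 : T⁻ = 0 := by rwa [← CStarRing.star_mul_self_eq_zero_iff, hD.star_eq]
    exact CStarAlgebra.nonneg_iff_eq_star_mul_self.mp ((CFC.negPart_eq_zero_iff T hT).mp h1)

/-- A Hermitian matrix over a C*-algebra whose quadratic form is nonnegative is positive. -/
theorem Matrix.IsHermitian.exists_eq_conjTranspose_mul_self {ι C : Type*} [Fintype ι]
    [NonUnitalCStarAlgebra C] [PartialOrder C] [StarOrderedRing C]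
    {T : Matrix ι ι C} (hT : T.IsHermitian)
    (h : ∀ b : ι → C, 0 ≤ ∑ i, ∑ j, star (b i) * T i j * b j) :
    ∃ S : Matrix ι ι C, T = Sᴴ * S := by
  have hT' : IsSelfAdjoint (CStarMatrix.ofMatrix T) := hT
  obtain ⟨D, R, hD, hDTD, hR⟩ := hT'.exists_compression_eq_neg_star_mul_self
  refine hR ?_
  ext r k
  have hsum : ∑ i, star (R i k) * R i k = 0 := by
    refine le_antisymm ?_ (Finset.sum_nonneg fun i _ => star_mul_self_nonneg _)
    rw [← neg_nonneg]
    convert h fun i => D i k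
    have hentry := congrFun (congrFun hDTD k) k
    simp only [CStarMatrix.mul_apply, CStarMatrix.neg_apply, Finset.sum_mul,
      CStarMatrix.star_apply] at hentry
    rw [← hentry, Finset.sum_comm]
    simp only [CStarMatrix.star_apply_of_isSelfAdjoint hD, CStarMatrix.ofMatrix_apply]
  exact CStarRing.star_mul_self_eq_zero_iff _ |>.mp <|
    (Finset.sum_eq_zero_iff_of_nonneg fun i _ => star_mul_self_nonneg _).mp hsum r
      (Finset.mem_univ r)

namespace CstarEquivBimodule

variable {A B : Type*}
  [NonUnitalCStarAlgebra A] [PartialOrder A] [StarOrderedRing A]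
  [NonUnitalCStarAlgebra B] [PartialOrder B] [StarOrderedRing B]
  (X : CstarEquivBimodule A B)

theorem innerB_rsmul_left (b : B) (x y : X.carrier) :
    X.innerB (X.rsmul b x) y = star b * X.innerB x y := by
  rw [← X.innerB_star, X.innerB_rsmul, star_mul, X.innerB_star]

theorem innerA_lsmul_right (a : A) (x y : X.carrier) :
    X.innerA x (X.lsmul a y) = X.innerA x y * star a := by
  rw [← X.innerA_star, X.innerA_lsmul, star_mul, X.innerA_star]

/-- The right action of `B` is faithful. -/
theorem eq_zero_of_forall_rsmul_eq_zero {d : B} (hd : ∀ x, X.rsmul d x = 0) : d = 0 := by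
  have hmem : ∀ c : B, c * d = 0 := by
    intro c
    have hc : c ∈ (Submodule.span ℂ {b : B | ∃ x y, b = X.innerB x y}).topologicalClosure := by
      rw [X.fullB]; trivial
    have hle : Submodule.span ℂ {b : B | ∃ x y, b = X.innerB x y} ≤
        LinearMap.ker (LinearMap.mulRight ℂ d) := by
      rw [Submodule.span_le]
      rintro _ ⟨x, y, rfl⟩
      simp [← X.innerB_rsmul, hd]
    have hclosed : IsClosed (LinearMap.ker (LinearMap.mulRight ℂ d) : Set B) :=
      isClosed_eq (continuous_mul_const d) continuous_const
    simpa using Submodule.topologicalClosure_minimal _ hle hclosed hc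
  exact CStarRing.star_mul_self_eq_zero_iff _ |>.mp (hmem (star d))

/-- The left action of `A` is adjointable for the `B`-valued inner product. -/
theorem innerB_lsmul_left (a : A) (y z : X.carrier) :
    X.innerB (X.lsmul a y) z = X.innerB y (X.lsmul (star a) z) := by
  rw [← sub_eq_zero]
  refine X.eq_zero_of_forall_rsmul_eq_zero fun x => ?_
  rw [map_sub, LinearMap.sub_apply, ← X.imprimitivity, ← X.imprimitivity,
    X.innerA_lsmul_right, X.lsmul_mul, sub_self]

/-- A sum of Gram matrices for the `B`-valued inner product is positive. -/
theorem exists_sum_innerB_eq_conjTranspose_mul_self {ι ρ : Type*} [Fintype ι] [Fintype ρ]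
    (y : ρ → ι → X.carrier) :
    ∃ C : Matrix ι ι B, (Matrix.of fun i j => ∑ r, X.innerB (y r i) (y r j)) = Cᴴ * C := by
  refine Matrix.IsHermitian.exists_eq_conjTranspose_mul_self ?_ fun b => ?_
  · ext i j
    simp [X.innerB_star]
  · have hform : ∑ i, ∑ j, star (b i) * (∑ r, X.innerB (y r i) (y r j)) * b j =
        ∑ r, X.innerB (∑ i, X.rsmul (b i) (y r i)) (∑ j, X.rsmul (b j) (y r j)) := by
      simp only [map_sum, LinearMap.sum_apply, X.innerB_rsmul, X.innerB_rsmul_left,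
        Finset.mul_sum, Finset.sum_mul]
      rw [Finset.sum_comm_cycle]
      exact Finset.sum_congr rfl fun r _ => Finset.sum_comm
    simp only [Matrix.of_apply, hform]
    exact Finset.sum_nonneg fun r _ => X.innerB_nonneg _

end CstarEquivBimodule

/-- Given an `A–B`-equivalence bimodule `X`, elements `u₁, …, u_n ∈ X` and a
completely positive map `ψ : B → B(K)`, the map `φ : A → M_n(B(K))` defined entrywise by
`φ(a)_{ij} = ψ(⟨u_i, a·u_j⟩_B)` is completely positive. -/
theorem entrywise_cp_map_is_completely_positive
    {A B : Type*}
    [NonUnitalCStarAlgebra A] [PartialOrder A] [StarOrderedRing A]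
    [NonUnitalCStarAlgebra B] [PartialOrder B] [StarOrderedRing B]
    (X : CstarEquivBimodule A B) {n : ℕ} (u : Fin n → X.carrier)
    {K : Type*} [NormedAddCommGroup K] [InnerProductSpace ℂ K] [CompleteSpace K]
    (ψ : B →ₗ[ℂ] (K →L[ℂ] K)) (hψ : IsCompletelyPositive ψ)
    (φ : A →ₗ[ℂ] Matrix (Fin n) (Fin n) (K →L[ℂ] K))
    (hφ : ∀ (a : A) (i j : Fin n), φ a i j = ψ (X.innerB (u i) (X.lsmul a (u j)))) :
    IsCompletelyPositive φ := by
  rintro m M ⟨P, rfl⟩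
  let e : Fin m × Fin n ≃ Fin (m * n) := finProdFinEquiv
  obtain ⟨Q, hQ⟩ := hψ (m * n) _ <| X.exists_sum_innerB_eq_conjTranspose_mul_self
    fun (r : Fin m) p => X.lsmul (P r (e.symm p).1) (u (e.symm p).2)
  refine ⟨.of fun k l => .of fun i j => Q (e (k, i)) (e (l, j)), ?_⟩
  ext k l : 1
  ext i j : 1
  have hentry := congrFun (congrFun hQ (e (k, i))) (e (l, j))
  simp only [Matrix.map_apply, Matrix.of_apply, Equiv.symm_apply_apply, Matrix.mul_apply,
    Matrix.conjTranspose_apply, X.innerB_lsmul_left, ← X.lsmul_mul] at hentry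
  simp only [Matrix.map_apply, hφ, Matrix.mul_apply, Matrix.conjTranspose_apply,
    Matrix.sum_apply, Matrix.of_apply, Matrix.star_apply, map_sum, LinearMap.sum_apply] at hentry ⊢
  rw [hentry, ← e.sum_comp, Fintype.sum_prod_type]
end

section
/- Let A and B be C*-algebras, X an A–B-equivalence bimodule, ψ : B → B(K) a completely positive linear map with minimal Stinespring representation (π_ψ, V_ψ, K_ψ), (π_A, H_A) the representation of A induced by X on H_A = X ⊗_B K_ψ, u₁, …, u_n ∈ X, φ : A → B(K ⊗ ℂⁿ) the completely positive map φ(a) = [ψ(⟨u_i, a·u_j⟩_B)]_{i,j=1}^n, and {b_p} an approximate unit of B. Then the linear map U on the algebraic tensor product A ⊙ (K ⊗ ℂⁿ) determined by U(a ⊗ (ξ ⊗ λ)) = weak-lim_p Σ_{i=1}^n λ_i (a·u_i) ⊗ π_ψ(b_p)V_ψξ, for a ∈ A, ξ ∈ K, λ = (λ₁, …, λ_n) ∈ ℂⁿ, is well defined and preserves inner products, where A ⊙ (K ⊗ ℂⁿ) carries the positive semidefinite form ⟨a ⊗ ζ, a' ⊗ ζ'⟩ = ⟨ζ, φ(a*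 a')ζ'⟩_{K ⊗ ℂⁿ}; hence U extends to a linear isometry from the minimal Stinespring space H_φ of φ into H_A. -/
open Filter Matrix
open scoped InnerProductSpace ComplexOrder

/-- An approximate unit of a C*-algebra `D`: a net `(d_i)` with `0 ≤ d_i`, `‖d_i‖ ≤ 1`, and
`‖x − x·d_i‖ → 0` for every `x ∈ D`. -/
structure IsApproxUnit {D : Type*}
    [NonUnitalCStarAlgebra D] [PartialOrder D] [StarOrderedRing D]
    {ι : Type*} [Preorder ι] (d : ι → D) : Prop where
  nonneg : ∀ i, 0 ≤ d i
  norm_le_one : ∀ i, ‖d i‖ ≤ 1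
  approx : ∀ x : D, Filter.Tendsto (fun i => ‖x - x * d i‖) Filter.atTop (nhds 0)

/-- Norm-preserving linear maps from a common domain, the first with dense range, are intertwined
by a linear isometry. -/
lemma exists_linearIsometry_of_norm_eq {M H₁ H₂ : Type*} [AddCommGroup M] [Module ℂ M]
    [NormedAddCommGroup H₁] [NormedSpace ℂ H₁]
    [NormedAddCommGroup H₂] [NormedSpace ℂ H₂] [CompleteSpace H₂]
    (e : M →ₗ[ℂ] H₁) (f : M →ₗ[ℂ] H₂) (he : DenseRange e) (hef : ∀ m, ‖f m‖ = ‖e m‖) :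
    ∃ U : H₁ →ₗᵢ[ℂ] H₂, ∀ m, U (e m) = f m := by
  have hU : ∀ m, f.extendOfNorm e (e m) = f m :=
    LinearMap.extendOfNorm_eq he ⟨1, fun m => by simp [hef]⟩
  refine ⟨⟨(f.extendOfNorm e).toLinearMap, fun x => ?_⟩, hU⟩
  refine he.induction ?_
    (isClosed_eq (f.extendOfNorm e).continuous.norm continuous_norm) x
  rintro _ ⟨m, rfl⟩
  exact (congrArg norm (hU m)).trans (hef m)

/-- Bilinear version of `exists_linearIsometry_of_norm_eq`: if two bilinear maps into Hilbert
spaces have the same Gram form, and the first has total range, then a linear isometry carries one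
to the other. -/
lemma exists_linearIsometry_of_inner_eq {E F H₁ H₂ : Type*}
    [AddCommGroup E] [Module ℂ E] [AddCommGroup F] [Module ℂ F]
    [NormedAddCommGroup H₁] [InnerProductSpace ℂ H₁]
    [NormedAddCommGroup H₂] [InnerProductSpace ℂ H₂] [CompleteSpace H₂]
    (S : E →ₗ[ℂ] F →ₗ[ℂ] H₁) (T : E →ₗ[ℂ] F →ₗ[ℂ] H₂)
    (hS : (Submodule.span ℂ {v : H₁ | ∃ x y, v = S x y}).topologicalClosure = ⊤)
    (hST : ∀ x y x' y', ⟪T x y, T x' y'⟫_ℂ = ⟪S x y, S x' y'⟫_ℂ) :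
    ∃ U : H₁ →ₗᵢ[ℂ] H₂, ∀ x y, U (S x y) = T x y := by
  have hinner : ∀ s t, ⟪TensorProduct.lift T s, TensorProduct.lift T t⟫_ℂ
      = ⟪TensorProduct.lift S s, TensorProduct.lift S t⟫_ℂ := by
    intro s t
    induction s using TensorProduct.induction_on with
    | zero => simp
    | add s₁ s₂ h₁ h₂ => simp only [map_add, inner_add_left, h₁, h₂]
    | tmul x y =>
      induction t using TensorProduct.induction_on with
      | zero => simp
      | add t₁ t₂ h₁ h₂ => simp only [map_add, inner_add_right, h₁, h₂]
      | tmul x' y' => simpa using hST x y x' y'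
  have hdense : DenseRange (TensorProduct.lift S) := by
    refine (Submodule.dense_iff_topologicalClosure_eq_top.mpr hS).mono ?_
    change _ ⊆ ((LinearMap.range (TensorProduct.lift S) : Submodule ℂ H₁) : Set H₁)
    refine SetLike.coe_subset_coe.mpr (Submodule.span_le.mpr ?_)
    rintro _ ⟨x, y, rfl⟩
    exact ⟨x ⊗ₜ[ℂ] y, by simp⟩
  obtain ⟨U, hU⟩ := exists_linearIsometry_of_norm_eq (TensorProduct.lift S)
    (TensorProduct.lift T) hdense fun m => by
      rw [@norm_eq_sqrt_re_inner ℂ, @norm_eq_sqrt_re_inner ℂ, hinner]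
  exact ⟨U, fun x y => by simpa using hU (x ⊗ₜ[ℂ] y)⟩

/-- An approximate unit is also a left approximate unit. -/
lemma IsApproxUnit.tendsto_mul_left {D : Type*}
    [NonUnitalCStarAlgebra D] [PartialOrder D] [StarOrderedRing D]
    {ι : Type*} [Preorder ι] {d : ι → D} (hd : IsApproxUnit d) (x : D) :
    Tendsto (fun i => d i * x) atTop (nhds x) := by
  rw [tendsto_iff_norm_sub_tendsto_zero]
  refine (hd.approx (star x)).congr fun i => ?_
  rw [← norm_star, star_sub, star_mul, star_star, (hd.nonneg i).isSelfAdjoint.star_eq,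
    norm_sub_rev]

/-- A nondegenerate representation maps approximate units to nets converging strongly to the
identity. -/
lemma NondegenerateRep.tendsto_approxUnit {D : Type*}
    [NonUnitalCStarAlgebra D] [PartialOrder D] [StarOrderedRing D]
    {H : Type*} [NormedAddCommGroup H] [InnerProductSpace ℂ H] [CompleteSpace H]
    {π : D →⋆ₙₐ[ℂ] (H →L[ℂ] H)} (hπ : NondegenerateRep π)
    {ι : Type*} [Preorder ι] {d : ι → D} (hd : IsApproxUnit d) (v : H) :
    Tendsto (fun i => π (d i) v) atTop (nhds v) := by
  have hnorm : ∀ i, ‖π (d i)‖ ≤ 1 := fun i =>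
    (NonUnitalStarAlgHom.norm_apply_le π (d i)).trans (hd.norm_le_one i)
  have hclosed : IsClosed {v : H | Tendsto (fun i => π (d i) v) atTop (nhds v)} := by
    refine Equicontinuous.isClosed_setOfPred_tendsto (F := fun i v => π (d i) v) (f := id)
      ?_ continuous_id
    refine LipschitzWith.uniformEquicontinuous _ 1 (fun i => ?_) |>.equicontinuous
    exact (π (d i)).lipschitz.weaken (by exact_mod_cast hnorm i)
  refine (Submodule.dense_iff_topologicalClosure_eq_top.mpr hπ).induction ?_ hclosed v
  intro v hv
  induction hv using Submodule.span_induction with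
  | mem v hv =>
    obtain ⟨c, w, rfl⟩ := hv
    have hcont : Continuous fun c => π c w :=
      (ContinuousLinearMap.apply ℂ H w).continuous.comp (map_continuous π)
    simpa [Function.comp_def] using (hcont.tendsto c).comp (hd.tendsto_mul_left c)
  | zero => simpa using tendsto_const_nhds
  | add v w _ _ hv hw => simpa using hv.add hw
  | smul c v _ hv => simpa using hv.const_smul c

/-- The representation in a minimal Stinespring triple is nondegenerate. -/
lemma IsMinimalStinespring.nondegenerateRep {D H L : Type*}
    [NonUnitalCStarAlgebra D] [PartialOrder D] [StarOrderedRing D]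
    [NormedAddCommGroup H] [InnerProductSpace ℂ H] [CompleteSpace H]
    [NormedAddCommGroup L] [InnerProductSpace ℂ L] [CompleteSpace L]
    {φ : D →ₗ[ℂ] (H →L[ℂ] H)} {π : D →⋆ₙₐ[ℂ] (L →L[ℂ] L)} {V : H →L[ℂ] L}
    (h : IsMinimalStinespring φ π V) : NondegenerateRep π := by
  refine top_le_iff.mp (h.minimal.ge.trans (Submodule.topologicalClosure_mono ?_))
  refine Submodule.span_mono ?_
  rintro _ ⟨a, v, rfl⟩
  exact ⟨a, V v, rfl⟩

/-- A linear map `T` with `⟪T ζ, T ζ'⟫ = ⟪ζ, P ζ'⟫` for a bounded `P` is continuous. -/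
lemma LinearMap.continuous_of_inner_eq {H L : Type*}
    [NormedAddCommGroup H] [InnerProductSpace ℂ H] [NormedAddCommGroup L] [InnerProductSpace ℂ L]
    (T : H →ₗ[ℂ] L) (P : H →L[ℂ] H) (hTP : ∀ ζ, ⟪T ζ, T ζ⟫_ℂ = ⟪ζ, P ζ⟫_ℂ) :
    Continuous T := by
  refine AddMonoidHomClass.continuous_of_bound T (√‖P‖) fun ζ => ?_
  refine abs_le_of_sq_le_sq' ?_ (by positivity) |>.2
  calc ‖T ζ‖ ^ 2 = ‖⟪ζ, P ζ⟫_ℂ‖ := by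
        rw [← hTP, inner_self_eq_norm_sq_to_K]; simp
    _ ≤ ‖ζ‖ * (‖P‖ * ‖ζ‖) := (norm_inner_le_norm _ _).trans (by gcongr; exact P.le_opNorm ζ)
    _ = (√‖P‖ * ‖ζ‖) ^ 2 := by rw [mul_pow, Real.sq_sqrt (norm_nonneg _)]; ring

/-- Given an `A–B`-equivalence bimodule `X`, a completely positive map
`ψ : B → B(K)` with minimal Stinespring representation `(π_ψ, V_ψ, K_ψ)`, `H_A = X ⊗_B K_ψ`,
elements `u₁, …, u_n ∈ X` and `φ(a) = [ψ(⟨u_i, a·u_j⟩_B)]_{ij} : A → B(K ⊗ ℂⁿ)`, the map `U`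
determined on `A ⊙ (K ⊗ ℂⁿ)` by
`U(a ⊗ (ξ ⊗ λ)) = weak-lim_p Σ_i λ_i (a·u_i) ⊗ π_ψ(b_p)V_ψ ξ` (for an approximate unit `(b_p)`
of `B`) is well defined, preserves the inner products, and extends to a linear isometry from
the minimal Stinespring space `H_φ` of `φ` into `H_A`. -/
theorem stinespring_isometry_into_induced_space
    {A B : Type*}
    [NonUnitalCStarAlgebra A] [PartialOrder A] [StarOrderedRing A]
    [NonUnitalCStarAlgebra B] [PartialOrder B] [StarOrderedRing B]
    (X : CstarEquivBimodule A B)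
    {K : Type*} [NormedAddCommGroup K] [InnerProductSpace ℂ K] [CompleteSpace K]
    (ψ : B →ₗ[ℂ] (K →L[ℂ] K)) (hψ : IsCompletelyPositive ψ)
    -- a minimal Stinespring representation (π_ψ, V_ψ, K_ψ) of ψ
    {Kψ : Type*} [NormedAddCommGroup Kψ] [InnerProductSpace ℂ Kψ] [CompleteSpace Kψ]
    (πψ : B →⋆ₙₐ[ℂ] (Kψ →L[ℂ] Kψ)) (Vψ : K →L[ℂ] Kψ)
    (hstine : IsMinimalStinespring ψ πψ Vψ)
    -- the Hilbert space H_A = X ⊗_B K_ψ with the induced representation of A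
    {HA : Type*} [NormedAddCommGroup HA] [InnerProductSpace ℂ HA] [CompleteSpace HA]
    (mkA : X.carrier →ₗ[ℂ] Kψ →ₗ[ℂ] HA)
    (hmkA_inner : ∀ (x x₁ : X.carrier) (ζ ζ₁ : Kψ),
      ⟪mkA x ζ, mkA x₁ ζ₁⟫_ℂ = ⟪ζ, πψ (X.innerB x x₁) ζ₁⟫_ℂ)
    (hmkA_dense :
      (Submodule.span ℂ
        {v : HA | ∃ (x : X.carrier) (ζ : Kψ), v = mkA x ζ}).topologicalClosure = ⊤)
    (πA : A →⋆ₙₐ[ℂ] (HA →L[ℂ] HA))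
    (hπA : ∀ (a : A) (x : X.carrier) (ζ : Kψ), πA a (mkA x ζ) = mkA (X.lsmul a x) ζ)
    -- the elements u₁, …, u_n and the entrywise map φ : A → B(K ⊗ ℂⁿ)
    {n : ℕ} (u : Fin n → X.carrier)
    (φ : A →ₗ[ℂ] ((PiLp 2 fun _ : Fin n => K) →L[ℂ] (PiLp 2 fun _ : Fin n => K)))
    (hφ : ∀ (a : A) (ζ : PiLp 2 fun _ : Fin n => K) (i : Fin n),
      φ a ζ i = ∑ j, ψ (X.innerB (u i) (X.lsmul a (u j))) (ζ j))
    -- the Hilbert space H_φ, the completion of A ⊙ (K ⊗ ℂⁿ) with respect to the Stinespring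
    -- form of φ
    {Hφ : Type*} [NormedAddCommGroup Hφ] [InnerProductSpace ℂ Hφ] [CompleteSpace Hφ]
    (mkφ : A →ₗ[ℂ] (PiLp 2 fun _ : Fin n => K) →ₗ[ℂ] Hφ)
    (hmkφ_inner : ∀ (a a' : A) (ζ ζ' : PiLp 2 fun _ : Fin n => K),
      ⟪mkφ a ζ, mkφ a' ζ'⟫_ℂ = ⟪ζ, φ (star a * a') ζ'⟫_ℂ)
    (hmkφ_dense :
      (Submodule.span ℂ
        {v : Hφ | ∃ (a : A) (ζ : PiLp 2 fun _ : Fin n => K), v = mkφ a ζ}).topologicalClosure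
        = ⊤) :
    ∃ U : Hφ →ₗᵢ[ℂ] HA,
      ∀ (a : A) (ξ : K) (lam : Fin n → ℂ)
        (ι' : Type*) (_ : Nonempty ι') (_ : SemilatticeSup ι') (b : ι' → B),
        IsApproxUnit b →
        ∀ w : HA,
          Filter.Tendsto
            (fun p => ⟪w, ∑ i, lam i • mkA (X.lsmul a (u i)) (πψ (b p) (Vψ ξ))⟫_ℂ)
            Filter.atTop
            (nhds ⟪w, U (mkφ a ((WithLp.equiv 2 (∀ _ : Fin n, K)).symm
              fun i => lam i • ξ))⟫_ℂ) := by
  have hmkA_cont : ∀ x, Continuous (mkA x) := fun x =>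
    (mkA x).continuous_of_inner_eq (πψ (X.innerB x x)) fun ζ => hmkA_inner x x ζ ζ
  let T : A →ₗ[ℂ] (PiLp 2 fun _ : Fin n => K) →ₗ[ℂ] HA :=
    LinearMap.mk₂ ℂ (fun a ζ => ∑ i, mkA (X.lsmul a (u i)) (Vψ (ζ i)))
      (fun a a' ζ => by simp [Finset.sum_add_distrib])
      (fun c a ζ => by simp [Finset.smul_sum])
      (fun a ζ ζ' => by simp [Finset.sum_add_distrib])
      (fun c a ζ => by simp [Finset.smul_sum])
  have hT : ∀ a ζ, T a ζ = ∑ i, mkA (X.lsmul a (u i)) (Vψ (ζ i)) := fun _ _ => rfl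
  have hterm : ∀ (a a' : A) (x y : X.carrier) (ξ ξ' : K),
      ⟪mkA (X.lsmul a x) (Vψ ξ), mkA (X.lsmul a' y) (Vψ ξ')⟫_ℂ
        = ⟪ξ, ψ (X.innerB x (X.lsmul (star a * a') y)) ξ'⟫_ℂ := by
    intro a a' x y ξ ξ'
    rw [← hπA a, ← ContinuousLinearMap.adjoint_inner_right, ← ContinuousLinearMap.star_eq_adjoint,
      ← map_star, hπA, ← X.lsmul_mul, hmkA_inner, hstine.dilation,
      ContinuousLinearMap.comp_apply, ContinuousLinearMap.adjoint_inner_right]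
    rfl
  obtain ⟨U, hU⟩ := exists_linearIsometry_of_inner_eq mkφ T hmkφ_dense fun a ζ a' ζ' => by
    simp only [hT, hmkφ_inner, PiLp.inner_apply, hφ, sum_inner, inner_sum, hterm]
    exact Finset.sum_comm
  refine ⟨U, fun a ξ lam ι' _ _ b hb w => ?_⟩
  rw [hU, hT]
  refine tendsto_const_nhds.inner (tendsto_finsetSum _ fun i _ => ?_)
  have hlim := ((hmkA_cont (X.lsmul a (u i))).tendsto (Vψ ξ)).comp
    (hstine.nondegenerateRep.tendsto_approxUnit hb (Vψ ξ))
  simpa using hlim.const_smul (lam i)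
end

section
/- Let A and B be unital C*-algebras, X an A–B-equivalence bimodule, and {u₁, …, u_n} a left A-basis of X, i.e., x = Σ_{i=1}^n ⟨x, u_i⟩_A · u_i for every x ∈ X. Let ψ : B → B(K) be a completely positive linear map with minimal Stinespring representation (π_ψ, V_ψ, K_ψ), (π_A, H_A) the representation of A induced by X on H_A = X ⊗_B K_ψ, φ(a) = [ψ(⟨u_i, a·u_j⟩_B)]_{i,j=1}^n : A → B(K ⊗ ℂⁿ), and U : H_φ → H_A the isometry determined by U(a ⊗ (ξ ⊗ λ)) = Σ_{i=1}^n λ_i (a·u_i) ⊗ V_ψξ. Then U is surjective, i.e., U is a surjective isometry from H_φ onto H_A. -/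
open Filter Matrix
open scoped InnerProductSpace ComplexOrder

section InducedSpace

variable {A B : Type*}
  [NonUnitalCStarAlgebra A] [PartialOrder A] [StarOrderedRing A]
  [NonUnitalCStarAlgebra B] [PartialOrder B] [StarOrderedRing B]
  (X : CstarEquivBimodule A B)
  {L H : Type*} [NormedAddCommGroup L] [InnerProductSpace ℂ L] [CompleteSpace L]
  [NormedAddCommGroup H] [InnerProductSpace ℂ H]
  (π : B →⋆ₙₐ[ℂ] (L →L[ℂ] L)) (mk : X.carrier →ₗ[ℂ] L →ₗ[ℂ] H)

/-- In a space carrying the inner product of `X ⊗_B L`, the map `ζ ↦ x ⊗ ζ` is continuous. -/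
theorem CstarEquivBimodule.continuous_tensor
    (hmk : ∀ (x x₁ : X.carrier) (ζ ζ₁ : L),
      ⟪mk x ζ, mk x₁ ζ₁⟫_ℂ = ⟪ζ, π (X.innerB x x₁) ζ₁⟫_ℂ)
    (x : X.carrier) : Continuous (mk x) := by
  refine AddMonoidHomClass.continuous_of_bound (mk x) √‖π (X.innerB x x)‖ fun ζ => ?_
  refine (sq_le_sq₀ (norm_nonneg _) (by positivity)).1 ?_
  rw [mul_pow, Real.sq_sqrt (norm_nonneg _)]
  calc ‖mk x ζ‖ ^ 2 = ‖⟪mk x ζ, mk x ζ⟫_ℂ‖ := by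
        rw [inner_self_eq_norm_sq_to_K]; simp
    _ = ‖⟪ζ, π (X.innerB x x) ζ⟫_ℂ‖ := by rw [hmk]
    _ ≤ ‖ζ‖ * ‖π (X.innerB x x) ζ‖ := norm_inner_le_norm _ _
    _ ≤ ‖ζ‖ * (‖π (X.innerB x x)‖ * ‖ζ‖) := by
        gcongr; exact (π (X.innerB x x)).le_opNorm ζ
    _ = ‖π (X.innerB x x)‖ * ‖ζ‖ ^ 2 := by ring

/-- In a space carrying the inner product of `X ⊗_B L`, the tensors are `B`-balanced:
`x·b ⊗ ζ = x ⊗ π(b)ζ`. -/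
theorem CstarEquivBimodule.tensor_balanced
    (hmk : ∀ (x x₁ : X.carrier) (ζ ζ₁ : L),
      ⟪mk x ζ, mk x₁ ζ₁⟫_ℂ = ⟪ζ, π (X.innerB x x₁) ζ₁⟫_ℂ)
    (x : X.carrier) (b : B) (ζ : L) : mk (X.rsmul b x) ζ = mk x (π b ζ) := by
  have key : ∀ (x₁ : X.carrier) (ζ₁ : L),
      ⟪mk (X.rsmul b x) ζ - mk x (π b ζ), mk x₁ ζ₁⟫_ℂ = 0 := fun x₁ ζ₁ => by
    rw [inner_sub_left, hmk, hmk, ← X.innerB_star x₁ (X.rsmul b x), X.innerB_rsmul, star_mul,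
      X.innerB_star, map_mul, map_star, ContinuousLinearMap.star_eq_adjoint,
      mul_apply_eq_comp, ContinuousLinearMap.adjoint_inner_right, sub_self]
  rw [← sub_eq_zero, ← inner_self_eq_zero (𝕜 := ℂ)]
  conv_lhs => rw [inner_sub_right, key, key, sub_zero]

end InducedSpace

/-- For unital C*-algebras `A`, `B`, an `A–B`-equivalence bimodule `X` with a
left `A`-basis `{u₁, …, u_n}`, and a completely positive map `ψ : B → B(K)`, the isometry
`U : H_φ → H_A` determined by `U(a ⊗ (ξ ⊗ λ)) = Σ_i λ_i (a·u_i) ⊗ V_ψ ξ` is surjective. -/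
theorem stinespring_isometry_surjective
    {A B : Type*}
    [CStarAlgebra A] [PartialOrder A] [StarOrderedRing A]
    [CStarAlgebra B] [PartialOrder B] [StarOrderedRing B]
    (X : CstarEquivBimodule A B)
    {K : Type*} [NormedAddCommGroup K] [InnerProductSpace ℂ K] [CompleteSpace K]
    (ψ : B →ₗ[ℂ] (K →L[ℂ] K)) (hψ : IsCompletelyPositive ψ)
    -- a minimal Stinespring representation (π_ψ, V_ψ, K_ψ) of ψ
    {Kψ : Type*} [NormedAddCommGroup Kψ] [InnerProductSpace ℂ Kψ] [CompleteSpace Kψ]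
    (πψ : B →⋆ₙₐ[ℂ] (Kψ →L[ℂ] Kψ)) (Vψ : K →L[ℂ] Kψ)
    (hstine : IsMinimalStinespring ψ πψ Vψ)
    -- the Hilbert space H_A = X ⊗_B K_ψ with the induced representation of A
    {HA : Type*} [NormedAddCommGroup HA] [InnerProductSpace ℂ HA] [CompleteSpace HA]
    (mkA : X.carrier →ₗ[ℂ] Kψ →ₗ[ℂ] HA)
    (hmkA_inner : ∀ (x x₁ : X.carrier) (ζ ζ₁ : Kψ),
      ⟪mkA x ζ, mkA x₁ ζ₁⟫_ℂ = ⟪ζ, πψ (X.innerB x x₁) ζ₁⟫_ℂ)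
    (hmkA_dense :
      (Submodule.span ℂ
        {v : HA | ∃ (x : X.carrier) (ζ : Kψ), v = mkA x ζ}).topologicalClosure = ⊤)
    (πA : A →⋆ₙₐ[ℂ] (HA →L[ℂ] HA))
    (hπA : ∀ (a : A) (x : X.carrier) (ζ : Kψ), πA a (mkA x ζ) = mkA (X.lsmul a x) ζ)
    -- the elements u₁, …, u_n and the entrywise map φ : A → B(K ⊗ ℂⁿ)
    {n : ℕ} (u : Fin n → X.carrier)
    -- (u_i) is a left A-basis of X : x = Σ_i ⟨x, u_i⟩_A · u_i
    (hbasis : ∀ x : X.carrier, x = ∑ i, X.lsmul (X.innerA x (u i)) (u i))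
    (φ : A →ₗ[ℂ] ((PiLp 2 fun _ : Fin n => K) →L[ℂ] (PiLp 2 fun _ : Fin n => K)))
    (hφ : ∀ (a : A) (ζ : PiLp 2 fun _ : Fin n => K) (i : Fin n),
      φ a ζ i = ∑ j, ψ (X.innerB (u i) (X.lsmul a (u j))) (ζ j))
    -- the Hilbert space H_φ, the completion of A ⊙ (K ⊗ ℂⁿ) with respect to the Stinespring
    -- form of φ
    {Hφ : Type*} [NormedAddCommGroup Hφ] [InnerProductSpace ℂ Hφ] [CompleteSpace Hφ]
    (mkφ : A →ₗ[ℂ] (PiLp 2 fun _ : Fin n => K) →ₗ[ℂ] Hφ)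
    (hmkφ_inner : ∀ (a a' : A) (ζ ζ' : PiLp 2 fun _ : Fin n => K),
      ⟪mkφ a ζ, mkφ a' ζ'⟫_ℂ = ⟪ζ, φ (star a * a') ζ'⟫_ℂ)
    (hmkφ_dense :
      (Submodule.span ℂ
        {v : Hφ | ∃ (a : A) (ζ : PiLp 2 fun _ : Fin n => K), v = mkφ a ζ}).topologicalClosure
        = ⊤)
    -- the isometry U determined by U(a ⊗ (ξ ⊗ λ)) = Σ_i λ_i (a·u_i) ⊗ V_ψ ξ
    (U : Hφ →ₗᵢ[ℂ] HA)
    (hU : ∀ (a : A) (ξ : K) (lam : Fin n → ℂ),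
      U (mkφ a ((WithLp.equiv 2 (∀ _ : Fin n, K)).symm fun i => lam i • ξ)) =
        ∑ i, lam i • mkA (X.lsmul a (u i)) (Vψ ξ)) :
    Function.Surjective U := by
  have closed : IsClosed (U.toLinearMap.range : Set HA) := by
    rw [LinearMap.coe_range]
    exact U.isometry.isClosedEmbedding.isClosed_range
  have mem_gen (a : A) (i : Fin n) (ξ : K) :
      mkA (X.lsmul a (u i)) (Vψ ξ) ∈ U.toLinearMap.range :=
    ⟨_, (hU a ξ (Pi.single i 1)).trans (by simp [Pi.single_apply])⟩
  have mem_V (x : X.carrier) (ξ : K) : mkA x (Vψ ξ) ∈ U.toLinearMap.range := by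
    rw [hbasis x, map_sum, LinearMap.sum_apply]
    exact Submodule.sum_mem _ fun i _ => mem_gen _ i ξ
  have mem_tensor (x : X.carrier) (ζ : Kψ) : mkA x ζ ∈ U.toLinearMap.range := by
    have closed_comap : IsClosed ((U.toLinearMap.range.comap (mkA x) : Submodule ℂ Kψ) : Set Kψ) :=
      closed.preimage (X.continuous_tensor πψ mkA hmkA_inner x)
    refine Submodule.topologicalClosure_minimal _ (Submodule.span_le.2 ?_) closed_comap
      (hstine.minimal.ge (Submodule.mem_top (x := ζ)))
    rintro _ ⟨b, ξ, rfl⟩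
    simp only [SetLike.mem_coe, Submodule.mem_comap]
    rw [← X.tensor_balanced πψ mkA hmkA_inner]
    exact mem_V _ ξ
  refine fun v => Submodule.topologicalClosure_minimal _ (Submodule.span_le.2 ?_) closed
    (hmkA_dense.ge (Submodule.mem_top (x := v)))
  rintro _ ⟨x, ζ, rfl⟩
  exact mem_tensor x ζ
end
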